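/- Let j ≥ 1 be an integer, 0 < Δ < 1 a real number, and a = (a₁, a₂, a₃) ∈ ℤ³ a nonzero vector with ⟨a, s*_j⟩ = 0 and Euclidean norm ‖a‖ < (Δ/3)·ρ^(j/4). Write a₁·s_{j−1} + a₂·s_j + a₃·s_{j+1} = (0, p, −q) with integers p, q, q ≠ 0. Then |p − q·σ| < Δ²/(2·|q|). -/

import Mathlib

open Matrix

noncomputable def cbrt2 : ℝ := (2 : ℝ) ^ ((1 : ℝ) / 3)
noncomputable def cbrt4 : ℝ := (2 : ℝ) ^ ((2 : ℝ) / 3)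
noncomputable def σ : ℝ := cbrt2 - 1
noncomputable def ρ : ℝ := 1 + cbrt2 + cbrt4

def S : Matrix (Fin 3) (Fin 3) ℤ := !![0, 0, 1; 1, 0, -3; 0, 1, -3]

theorem cbrt2_pow_three : cbrt2 ^ 3 = 2 := by
  rw [cbrt2, ← Real.rpow_natCast, ← Real.rpow_mul (by norm_num)]
  norm_num

theorem cbrt4_eq_sq : cbrt4 = cbrt2 ^ 2 := by
  rw [cbrt2, cbrt4, ← Real.rpow_natCast, ← Real.rpow_mul (by norm_num)]
  norm_num

theorem cbrt2_gt : 1.2599 < cbrt2 := by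
  have h := cbrt2_pow_three
  have h0 : 0 ≤ cbrt2 := by unfold cbrt2; positivity
  exact lt_of_pow_lt_pow_left₀ 3 h0 (by rw [h]; norm_num)

theorem cbrt2_lt : cbrt2 < 1.26 :=
  lt_of_pow_lt_pow_left₀ 3 (by norm_num) (by rw [cbrt2_pow_three]; norm_num)

theorem ρ_eq : ρ = 1 + cbrt2 + cbrt2 ^ 2 := by
  rw [ρ, cbrt4_eq_sq]

theorem σ_mul_ρ : σ * ρ = 1 := by
  rw [σ, ρ_eq]
  linear_combination cbrt2_pow_three

theorem ρ_lt : ρ < 3.848 := by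
  rw [ρ_eq]
  nlinarith [cbrt2_lt, cbrt2_gt]

theorem ρ_gt : 3.84 < ρ := by
  rw [ρ_eq]
  nlinarith [cbrt2_lt, cbrt2_gt]

theorem ρ_sq_mul_le : ρ ^ 2 * (1 + σ ^ 2 + σ ^ 4) ≤ 15.9 := by
  have h1 : ρ ^ 2 * (1 + σ ^ 2 + σ ^ 4) = ρ ^ 2 + 1 + σ ^ 2 := by
    linear_combination (1 + σ ^ 2) * (σ * ρ + 1) * σ_mul_ρ
  have h2 : σ ^ 2 ≤ 0.07 := by
    unfold σ
    nlinarith [cbrt2_gt, cbrt2_lt]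
  nlinarith [ρ_gt, ρ_lt]

theorem one_add_ρ_add_ρ_sq_le : 1 + ρ + ρ ^ 2 ≤ 1.08 * (ρ * (3 * cbrt2 ^ 2)) := by
  have h1 : 1.587 ≤ cbrt2 ^ 2 := by nlinarith [cbrt2_gt]
  have h2 := mul_le_mul_of_nonneg_left h1 (by linarith [ρ_gt] : 0 ≤ ρ)
  nlinarith [ρ_gt, ρ_lt]

/-- The element of `ℤ[σ]` with coordinate vector `v`. -/
noncomputable def realEval (v : Fin 3 → ℤ) : ℝ := v 0 + v 1 * σ + v 2 * σ ^ 2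

/-- The squared absolute value of the complex conjugate of `realEval v`. -/
noncomputable def conjNormSq (v : Fin 3 → ℤ) : ℝ :=
  (v 0 - (1 + cbrt2 / 2) * v 1 + (1 + cbrt2 - cbrt2 ^ 2 / 2) * v 2) ^ 2
    + 3 * cbrt2 ^ 2 / 4 * (v 1 - (cbrt2 + 2) * v 2) ^ 2

theorem S_mulVec (v : Fin 3 → ℤ) :
    S.mulVec v = ![v 2, v 0 - 3 * v 2, v 1 - 3 * v 2] := by
  ext i
  fin_cases i <;> simp [S, Matrix.mulVec, dotProduct, Fin.sum_univ_three] <;> ring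

theorem realEval_S_mulVec (v : Fin 3 → ℤ) : realEval (S.mulVec v) = σ * realEval v := by
  simp only [S_mulVec, realEval, σ, cons_val]
  push_cast
  linear_combination (-(v 2 : ℝ)) * cbrt2_pow_three

theorem conjNormSq_S_mulVec (v : Fin 3 → ℤ) :
    conjNormSq (S.mulVec v) = ρ * conjNormSq v := by
  simp only [S_mulVec, conjNormSq, ρ_eq, cons_val]
  push_cast
  grind [cbrt2_pow_three]

theorem S_mulVec_injective : Function.Injective S.mulVec := by
  intro v w h
  rw [S_mulVec, S_mulVec] at h
  have h0 := congrFun h 0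
  have h1 := congrFun h 1
  have h2 := congrFun h 2
  simp only [cons_val] at h0 h1 h2
  ext i
  fin_cases i <;> simp only [Fin.zero_eta, Fin.mk_one, Fin.reduceFinMk] <;> omega

theorem sq_dot_le (x y z a b c : ℝ) :
    (x * a + y * b + z * c) ^ 2 ≤ (x ^ 2 + y ^ 2 + z ^ 2) * (a ^ 2 + b ^ 2 + c ^ 2) := by
  nlinarith [sq_nonneg (x * b - y * a), sq_nonneg (x * c - z * a), sq_nonneg (y * c - z * b)]

theorem realEval_sq_le (v : Fin 3 → ℤ) :
    realEval v ^ 2 ≤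
      (1 + σ ^ 2 + σ ^ 4) * ((v 0 : ℝ) ^ 2 + (v 1 : ℝ) ^ 2 + (v 2 : ℝ) ^ 2) := by
  have h := sq_dot_le 1 σ (σ ^ 2) (v 0) (v 1) (v 2)
  unfold realEval
  linarith

theorem conjNormSq_le (v : Fin 3 → ℤ) :
    conjNormSq v ≤
      (1 + ρ + ρ ^ 2) * ((v 0 : ℝ) ^ 2 + (v 1 : ℝ) ^ 2 + (v 2 : ℝ) ^ 2) := by
  have h := sq_dot_le 1 (-(1 + cbrt2 / 2)) (1 + cbrt2 - cbrt2 ^ 2 / 2) (v 0) (v 1) (v 2)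
  have h' := mul_le_mul_of_nonneg_left (sq_dot_le 0 1 (-(cbrt2 + 2)) (v 0) (v 1) (v 2))
    (show 0 ≤ 3 * cbrt2 ^ 2 / 4 by positivity)
  unfold conjNormSq
  rw [ρ_eq]
  linarith

/-- The final numerical estimate, with `t` playing the role of `ρ ^ (j / 2)` and `N` that of the
squared norm of the orthogonal vector. -/
theorem abs_mul_lt_of_bounds {q u t N Δ : ℝ} (hN : 1 ≤ N) (hΔ0 : 0 < Δ) (hΔ1 : Δ < 1)
    (ht : 0 < t) (hNt : N < Δ ^ 2 / 9 * t) (hu : t ^ 4 * u ^ 2 ≤ 15.9 * N)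
    (hq : (q + u / (2 * cbrt2)) ^ 2 ≤ 1.08 * t ^ 2 * N) :
    |q * u| < Δ ^ 2 / 2 := by
  have hc := cbrt2_gt
  set z := q + u / (2 * cbrt2) with hz
  have ht9 : 9 < t := by nlinarith
  have hzu : |z * u| ≤ 4.15 / 9 * Δ ^ 2 := by
    have h1 : (t * |z * u|) ^ 2 ≤ (4.15 * N) ^ 2 := by
      have h2 := mul_le_mul hq hu (by positivity) (by positivity)
      have h3 : t ^ 2 * (t * |z * u|) ^ 2 ≤ t ^ 2 * (4.15 * N) ^ 2 := by
        rw [mul_pow, sq_abs]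
        nlinarith [mul_nonneg (sq_nonneg t) (sq_nonneg N)]
      exact le_of_mul_le_mul_left h3 (by positivity)
    have h4 := le_of_sq_le_sq h1 (by positivity)
    refine le_of_mul_le_mul_left (a := t) ?_ ht
    nlinarith
  have hu2 : u ^ 2 ≤ 0.01 * Δ ^ 2 := by
    have h3 : (729 : ℝ) ≤ t ^ 3 := by
      have := pow_le_pow_left₀ (by norm_num) ht9.le 3
      norm_num at this ⊢
      exact this
    have h5 : t ^ 3 * u ^ 2 ≤ 15.9 / 9 * Δ ^ 2 := by
      refine le_of_mul_le_mul_left (a := t) ?_ ht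
      nlinarith
    nlinarith [mul_le_mul_of_nonneg_right h3 (sq_nonneg u)]
  have hqu : q * u = z * u - u ^ 2 / (2 * cbrt2) := by
    rw [hz]; ring
  have hdiv : u ^ 2 / (2 * cbrt2) ≤ u ^ 2 := div_le_self (sq_nonneg u) (by linarith)
  have hdiv0 : 0 ≤ u ^ 2 / (2 * cbrt2) := by positivity
  rw [hqu, abs_lt]
  obtain ⟨h1, h2⟩ := abs_le.mp hzu
  have : 0 < Δ ^ 2 := by positivity
  constructor <;> linarith

theorem very_short_orthogonal_vector_gives_good_approximation
    (s : ℤ → (Fin 3 → ℤ))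
    (hs0 : s 0 = ![0, 1, 0])
    (hs : ∀ j : ℤ, s (j + 1) = S.mulVec (s j))
    (sstar : ℤ → (Fin 3 → ℤ))
    (hsstar0 : sstar 0 = ![1, 0, 0])
    (hsstar : ∀ j : ℤ, sstar (j + 1) = Sᵀ.mulVec (sstar j))
    (j : ℤ) (hj : 1 ≤ j)
    (Δ : ℝ) (hΔ0 : 0 < Δ) (hΔ1 : Δ < 1)
    (a : Fin 3 → ℤ) (ha : a ≠ 0)
    (horth : a ⬝ᵥ sstar j = 0)
    (hshort : Real.sqrt ((a 0 : ℝ) ^ 2 + (a 1 : ℝ) ^ 2 + (a 2 : ℝ) ^ 2)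
      < (Δ / 3) * ρ ^ ((j : ℝ) / 4))
    (p q : ℤ) (hq : q ≠ 0)
    (hpq : a 0 • s (j - 1) + a 1 • s j + a 2 • s (j + 1) = ![0, p, -q]) :
    |(p : ℝ) - (q : ℝ) * σ| < Δ ^ 2 / (2 * |(q : ℝ)|) := by
  obtain ⟨n, rfl⟩ := Int.eq_ofNat_of_zero_le (by omega : 0 ≤ j)
  have hsm1 : s (-1) = ![1, 0, 0] := by
    apply S_mulVec_injective
    rw [← hs (-1), show (-1 : ℤ) + 1 = 0 by norm_num, hs0, S_mulVec]
    simp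
  have hs1 : s 1 = ![0, 0, 1] := by
    rw [← zero_add (1 : ℤ), hs 0, hs0, S_mulVec]
    simp
  have key : ∀ m : ℕ,
      realEval (a 0 • s (m - 1) + a 1 • s m + a 2 • s (m + 1)) = σ ^ m * realEval a ∧
      conjNormSq (a 0 • s (m - 1) + a 1 • s m + a 2 • s (m + 1)) = ρ ^ m * conjNormSq a := by
    intro m
    induction m with
    | zero =>
      have h : a 0 • s (-1) + a 1 • s 0 + a 2 • s 1 = a := by
        rw [hs0, hs1, hsm1]
        ext i
        fin_cases i <;> simp
      rw [Nat.cast_zero, zero_sub, zero_add, h]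
      simp
    | succ m ih =>
      have h : a 0 • s ((m + 1 : ℕ) - 1) + a 1 • s (m + 1 : ℕ) + a 2 • s ((m + 1 : ℕ) + 1)
          = S.mulVec (a 0 • s (m - 1) + a 1 • s m + a 2 • s (m + 1)) := by
        rw [Matrix.mulVec_add, Matrix.mulVec_add, Matrix.mulVec_smul, Matrix.mulVec_smul,
          Matrix.mulVec_smul, ← hs, ← hs, ← hs]
        push_cast
        rw [add_sub_cancel_right, sub_add_cancel]
      rw [h, realEval_S_mulVec, conjNormSq_S_mulVec, ih.1, ih.2]
      constructor <;> ring
  obtain ⟨hL, hQ⟩ := key n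
  rw [hpq] at hL hQ
  set N : ℝ := (a 0 : ℝ) ^ 2 + (a 1 : ℝ) ^ 2 + (a 2 : ℝ) ^ 2 with hN
  have hN1 : 1 ≤ N := by
    have h : 0 < a 0 ^ 2 + a 1 ^ 2 + a 2 ^ 2 := by
      by_contra! h
      apply ha
      have h0 := sq_nonneg (a 0)
      have h1 := sq_nonneg (a 1)
      have h2 := sq_nonneg (a 2)
      ext i
      fin_cases i
      · exact pow_eq_zero_iff two_ne_zero |>.mp (by simp only [Fin.zero_eta]; omega)
      · exact pow_eq_zero_iff two_ne_zero |>.mp (by simp only [Fin.mk_one]; omega)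
      · exact pow_eq_zero_iff two_ne_zero |>.mp (by simp only [Fin.reduceFinMk]; omega)
    rw [hN]
    exact_mod_cast h
  have hc := cbrt2_gt
  have hσρ := σ_mul_ρ
  have hρ0 : 0 < ρ := by linarith [ρ_gt]
  set t : ℝ := (ρ ^ ((n : ℝ) / 4)) ^ 2 with ht
  have ht0 : 0 < t := by positivity
  have ht2 : t ^ 2 = ρ ^ n := by
    rw [ht, ← pow_mul, ← Real.rpow_natCast, ← Real.rpow_mul hρ0.le, ← Real.rpow_natCast]
    congr 1
    push_cast
    ring
  have hNt : N < Δ ^ 2 / 9 * t := by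
    have h := (Real.sqrt_lt' (by positivity)).mp hshort
    calc N < _ := h
      _ = Δ ^ 2 / 9 * t := by simp [ht]; ring
  set u : ℝ := p - q * σ with hu
  have hL' : σ * u = σ ^ n * realEval a := by
    rw [← hL, hu]
    simp [realEval]
    ring
  have hu4 : t ^ 4 * u ^ 2 ≤ 15.9 * N := by
    have h : t ^ 2 * u = ρ * realEval a := by
      have hn : σ ^ n * ρ ^ n = 1 := by rw [← mul_pow, hσρ, one_pow]
      rw [ht2]
      linear_combination (-(ρ ^ n * u)) * hσρ + ρ * ρ ^ n * hL' + ρ * realEval a * hn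
    have hle := mul_le_mul_of_nonneg_left (realEval_sq_le a) (sq_nonneg ρ)
    calc t ^ 4 * u ^ 2 = (t ^ 2 * u) ^ 2 := by ring
      _ = ρ ^ 2 * realEval a ^ 2 := by rw [h]; ring
      _ ≤ ρ ^ 2 * (1 + σ ^ 2 + σ ^ 4) * N := by linarith
      _ ≤ 15.9 * N := mul_le_mul_of_nonneg_right ρ_sq_mul_le (by linarith)
  have hq2 : ((q : ℝ) + u / (2 * cbrt2)) ^ 2 ≤ 1.08 * t ^ 2 * N := by
    have h : ρ * (3 * cbrt2 ^ 2 * q ^ 2 + 3 * cbrt2 * q * u + u ^ 2) = t ^ 2 * conjNormSq a := by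
      rw [ht2, ← hQ, hu]
      simp only [conjNormSq, σ, ρ_eq, cons_val]
      push_cast
      ring
    have hsq : 3 * cbrt2 ^ 2 * ((q : ℝ) + u / (2 * cbrt2)) ^ 2
        = 3 * cbrt2 ^ 2 * q ^ 2 + 3 * cbrt2 * q * u + u ^ 2 - u ^ 2 / 4 := by
      field_simp
      ring
    have hle := mul_le_mul_of_nonneg_left (conjNormSq_le a) (sq_nonneg t)
    have hpos : 0 < ρ * (3 * cbrt2 ^ 2) := by positivity
    have htN : 0 ≤ t ^ 2 * N := by positivity
    refine le_of_mul_le_mul_left (a := ρ * (3 * cbrt2 ^ 2)) ?_ hpos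
    calc ρ * (3 * cbrt2 ^ 2) * ((q : ℝ) + u / (2 * cbrt2)) ^ 2
        = t ^ 2 * conjNormSq a - ρ * (u ^ 2 / 4) := by rw [mul_assoc, hsq, ← h]; ring
      _ ≤ t ^ 2 * conjNormSq a := by
        have : 0 ≤ ρ * (u ^ 2 / 4) := by positivity
        linarith
      _ ≤ (1 + ρ + ρ ^ 2) * (t ^ 2 * N) := by linarith
      _ ≤ 1.08 * (ρ * (3 * cbrt2 ^ 2)) * (t ^ 2 * N) := mul_le_mul_of_nonneg_right one_add_ρ_add_ρ_sq_le htN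
      _ = _ := by ring
  have hfinal := abs_mul_lt_of_bounds hN1 hΔ0 hΔ1 ht0 hNt hu4 hq2
  have hq0 : 0 < |(q : ℝ)| := abs_pos.mpr (by exact_mod_cast hq)
  rw [abs_mul] at hfinal
  rw [lt_div_iff₀ (by positivity)]
  linarith
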